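/- arXiv:math/9904151 — 4 statements merged into one kernel-verified Lean document; each statement's English description precedes it below -/
import Mathlib

section
/- For ε ∈ (−ε₀, ε₀) consider the family (3)_ε of holomorphic vector fields on a fixed polydisc in ℂ²: ż = z(1 + Q(z,t,ε)) + g(t,ε)·p(t,ε), ṫ = p(t,ε) + z·R(z,t,ε), where p(t,ε) = ∏_{i=0}^{k}(t − α_i(ε)); Q, g, R are holomorphic in (z,t) and jointly continuous in ε; the α_i(ε) are continuous with α_i(0) = 0 (not necessarily distinct); Q(0,0,0) = 0 and R(z,t,0) ≡ 0. Then there exist ε₁ > 0 and a polydisc U = U_z × U_t around 0 such that for every |ε| < ε₁ and every i ∈ {0, …, k} there is a holomorphic function F_{i,ε} : U_z → U_t with: F_{i,ε}(0) = α_i(ε); the graph {t = F_{i,ε}(z)} is tangent to (3)_ε, i.e. F_{i,ε}′(z)·( z(1 + Q(z, F_{i,ε}(z), ε)) + g(F_{i,ε}(z), ε)·p(F_{i,ε}(z), ε) ) = p(F_{i,ε}(z), ε) + z·R(z, F_{i,ε}(z), ε) for all z ∈ U_z (so the graph lies in the separatrix of (3)_ε through (0, α_i(ε)) tangent to the eigendirection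 whose eigenvalue tends to 1); |F_{i,ε}′(z)| ≤ 1 and |F_{i,ε}(z) − α_i(ε)| ≤ |z| on U_z; and F_{i,ε} depends continuously on ε (uniformly on compact subsets of U_z), with F_{i,0} ≡ 0. -/
noncomputable section

open Complex Set Filter Metric

/-- The mean of `w` along the segment from `0` to `z`. -/
def radialMean (w : ℂ → ℂ) (z : ℂ) : ℂ := ∫ s in (0 : ℝ)..1, w (s * z)

lemma ofReal_mul_mem_ball {r : ℝ} {z : ℂ} (hz : z ∈ ball (0 : ℂ) r) {s : ℝ}
    (hs : s ∈ Icc (0 : ℝ) 1) : (s : ℂ) * z ∈ ball (0 : ℂ) r := by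
  rw [mem_ball_zero_iff] at hz ⊢
  rw [norm_mul, Complex.norm_real, Real.norm_of_nonneg hs.1]
  exact (mul_le_of_le_one_left (norm_nonneg z) hs.2).trans_lt hz

lemma intervalIntegrable_comp_ofReal_mul {w : ℂ → ℂ} {r : ℝ}
    (hw : ContinuousOn w (ball 0 r)) {z : ℂ} (hz : z ∈ ball (0 : ℂ) r) :
    IntervalIntegrable (fun s : ℝ => w (s * z)) MeasureTheory.volume 0 1 := by
  apply ContinuousOn.intervalIntegrable
  rw [uIcc_of_le zero_le_one]
  exact hw.comp (by fun_prop) fun s hs => ofReal_mul_mem_ball hz hs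

lemma norm_radialMean_le {w : ℂ → ℂ} {r C : ℝ} (hw : ∀ z ∈ ball (0 : ℂ) r, ‖w z‖ ≤ C)
    {z : ℂ} (hz : z ∈ ball (0 : ℂ) r) : ‖radialMean w z‖ ≤ C := by
  have := intervalIntegral.norm_integral_le_of_norm_le_const (a := (0 : ℝ)) (b := 1)
    (f := fun s : ℝ => w (s * z)) (C := C) fun s hs => by
      rw [uIoc_of_le zero_le_one] at hs
      exact hw _ (ofReal_mul_mem_ball hz ⟨hs.1.le, hs.2⟩)
  simpa [radialMean] using this

lemma radialMean_sub {w v : ℂ → ℂ} {r : ℝ} (hw : ContinuousOn w (ball 0 r))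
    (hv : ContinuousOn v (ball 0 r)) {z : ℂ} (hz : z ∈ ball (0 : ℂ) r) :
    radialMean (fun x => w x - v x) z = radialMean w z - radialMean v z :=
  intervalIntegral.integral_sub (intervalIntegrable_comp_ofReal_mul hw hz)
    (intervalIntegrable_comp_ofReal_mul hv hz)

lemma norm_radialMean_sub_le {w v : ℂ → ℂ} {r C : ℝ} (hw : ContinuousOn w (ball 0 r))
    (hv : ContinuousOn v (ball 0 r)) (h : ∀ z ∈ ball (0 : ℂ) r, ‖w z - v z‖ ≤ C)
    {z : ℂ} (hz : z ∈ ball (0 : ℂ) r) : ‖radialMean w z - radialMean v z‖ ≤ C := by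
  rw [← radialMean_sub hw hv hz]
  exact norm_radialMean_le h hz

lemma mul_radialMean_eq_sub {w P : ℂ → ℂ} {r : ℝ} (hw : ContinuousOn w (ball 0 r))
    (hP : ∀ z ∈ ball (0 : ℂ) r, HasDerivAt P (w z) z) {z : ℂ} (hz : z ∈ ball (0 : ℂ) r) :
    z * radialMean w z = P z - P 0 := by
  have h := intervalIntegral.integral_eq_sub_of_hasDerivAt (a := (0 : ℝ)) (b := 1)
    (f := fun s : ℝ => P (s * z)) (f' := fun s : ℝ => w (s * z) * z)
    (fun s hs => by
      rw [uIcc_of_le zero_le_one] at hs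
      have h1 : HasDerivAt (fun s : ℝ => (s : ℂ) * z) z s := by
        simpa using (Complex.ofRealCLM.hasDerivAt (x := s)).mul_const z
      exact (hP _ (ofReal_mul_mem_ball hz hs)).comp s h1)
    ((intervalIntegrable_comp_ofReal_mul hw hz).mul_const z)
  rw [intervalIntegral.integral_mul_const] at h
  simpa [radialMean, mul_comm] using h

lemma hasDerivAt_mul_radialMean {w : ℂ → ℂ} {r : ℝ} (hw : DifferentiableOn ℂ w (ball 0 r))
    {z : ℂ} (hz : z ∈ ball (0 : ℂ) r) :
    HasDerivAt (fun x => x * radialMean w x) (w z) z := by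
  obtain ⟨P, hP⟩ := hw.isExactOn_ball
  refine ((hP z hz).sub_const (P 0)).congr_of_eventuallyEq ?_
  filter_upwards [isOpen_ball.mem_nhds hz] with x hx
  exact mul_radialMean_eq_sub hw.continuousOn hP hx

lemma differentiableOn_radialMean {w : ℂ → ℂ} {r : ℝ}
    (hw : DifferentiableOn ℂ w (ball 0 r)) :
    DifferentiableOn ℂ (radialMean w) (ball 0 r) := by
  rcases le_or_gt r 0 with hr | hr
  · rw [ball_eq_empty.2 hr]
    exact differentiableOn_empty
  have hd := (Complex.differentiableOn_dslope (isOpen_ball.mem_nhds (mem_ball_self hr))).2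
    fun z hz => (hasDerivAt_mul_radialMean hw hz).differentiableAt.differentiableWithinAt
  refine hd.congr fun z hz => ?_
  rcases eq_or_ne z 0 with rfl | hz0
  · rw [dslope_same, (hasDerivAt_mul_radialMean hw hz).deriv]
    simp [radialMean]
  · rw [dslope_of_ne _ hz0, slope_def_field]
    field_simp
    simp

/-- The holomorphic functions on `ball 0 r` bounded by `1`. -/
def holoUnitBall (r : ℝ) : Set (ℂ → ℂ) :=
  {w | DifferentiableOn ℂ w (ball 0 r) ∧ ∀ z ∈ ball (0 : ℂ) r, ‖w z‖ ≤ 1}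

/-- `T` halves sup-distances on the functions in `holoUnitBall r`. -/
def HalvesDistances (r : ℝ) (T : (ℂ → ℂ) → ℂ → ℂ) : Prop :=
  ∀ w ∈ holoUnitBall r, ∀ v ∈ holoUnitBall r, ∀ C : ℝ,
    (∀ z ∈ ball (0 : ℂ) r, ‖w z - v z‖ ≤ C) → ∀ z ∈ ball (0 : ℂ) r, ‖T w z - T v z‖ ≤ C / 2

lemma HalvesDistances.norm_sub_le {r η : ℝ} {T : (ℂ → ℂ) → ℂ → ℂ} (hT : HalvesDistances r T)
    {w v : ℂ → ℂ} (hw : w ∈ holoUnitBall r) (hv : v ∈ holoUnitBall r)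
    (hfix : ∀ z ∈ ball (0 : ℂ) r, T w z = w z)
    (happrox : ∀ z ∈ ball (0 : ℂ) r, ‖T v z - v z‖ ≤ η) {z : ℂ} (hz : z ∈ ball (0 : ℂ) r) :
    ‖w z - v z‖ ≤ 2 * η := by
  have key : ∀ n : ℕ, ∀ z ∈ ball (0 : ℂ) r, ‖w z - v z‖ ≤ 2 * (1 / 2) ^ n + 2 * η := by
    intro n
    induction n with
    | zero =>
      intro z hz
      have h0 := (norm_nonneg _).trans (happrox z hz)
      have h1 := _root_.norm_sub_le (w z) (v z)
      have h2 := hw.2 z hz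
      have h3 := hv.2 z hz
      linarith
    | succ n ih =>
      intro z hz
      have h1 := hT w hw v hv _ ih z hz
      have h2 := norm_add_le (T w z - T v z) (T v z - v z)
      rw [sub_add_sub_cancel, hfix z hz] at h2
      have h3 := happrox z hz
      rw [hfix z hz] at h1
      rw [pow_succ]
      linarith
  have hlim : Tendsto (fun n : ℕ => 2 * (1 / 2 : ℝ) ^ n + 2 * η) atTop (nhds (2 * 0 + 2 * η)) :=
    ((tendsto_pow_atTop_nhds_zero_of_lt_one (by norm_num) (by norm_num)).const_mul 2).add_const _
  simpa using ge_of_tendsto' hlim fun n => key n z hz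

lemma HalvesDistances.exists_fixedPoint {r : ℝ} {T : (ℂ → ℂ) → ℂ → ℂ}
    (hT : HalvesDistances r T) (hmaps : MapsTo T (holoUnitBall r) (holoUnitBall r)) :
    ∃ w ∈ holoUnitBall r, ∀ z ∈ ball (0 : ℂ) r, T w z = w z := by
  set f : ℕ → ℂ → ℂ := fun n => T^[n] 0 with hf
  have hsucc : ∀ n, f (n + 1) = T (f n) := fun n => Function.iterate_succ_apply' T n 0
  have hmem : ∀ n, f n ∈ holoUnitBall r := by
    intro n
    exact hmaps.iterate n ⟨differentiableOn_const 0, fun z _ => by simp⟩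
  have hdist : ∀ n, ∀ z ∈ ball (0 : ℂ) r, ‖f n z - f (n + 1) z‖ ≤ 2 * (1 / 2) ^ n := by
    intro n
    induction n with
    | zero =>
      intro z hz
      have h1 := _root_.norm_sub_le (f 0 z) (f (0 + 1) z)
      have h2 := (hmem 0).2 z hz
      have h3 := (hmem (0 + 1)).2 z hz
      linarith
    | succ n ih =>
      intro z hz
      have := hT _ (hmem n) _ (hmem (n + 1)) _ ih z hz
      rw [← hsucc, ← hsucc] at this
      rw [pow_succ]
      linarith
  have hlim : ∀ z, ∃ l, z ∈ ball (0 : ℂ) r → Tendsto (fun n => f n z) atTop (nhds l) := by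
    intro z
    by_cases hz : z ∈ ball (0 : ℂ) r
    · obtain ⟨l, hl⟩ := cauchySeq_tendsto_of_complete (cauchySeq_of_le_geometric (1 / 2) 2
        (by norm_num) (f := fun n => f n z) fun n => by
          rw [dist_eq_norm]; exact hdist n z hz)
      exact ⟨l, fun _ => hl⟩
    · exact ⟨0, fun h => absurd h hz⟩
  choose w hw using hlim
  have hdw : ∀ n, ∀ z ∈ ball (0 : ℂ) r, ‖f n z - w z‖ ≤ 4 * (1 / 2) ^ n := by
    intro n z hz
    have := dist_le_of_le_geometric_of_tendsto (1 / 2) 2 (by norm_num) (f := fun n => f n z)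
      (fun n => by rw [dist_eq_norm]; exact hdist n z hz) (hw z hz) n
    rw [dist_eq_norm] at this
    exact this.trans_eq (by ring)
  have hpow : Tendsto (fun n : ℕ => 4 * (1 / 2 : ℝ) ^ n) atTop (nhds 0) := by
    simpa using (tendsto_pow_atTop_nhds_zero_of_lt_one (r := (1 / 2 : ℝ))
      (by norm_num) (by norm_num)).const_mul 4
  have hunif : TendstoUniformlyOn f w atTop (ball 0 r) := by
    rw [Metric.tendstoUniformlyOn_iff]
    intro e he
    filter_upwards [hpow.eventually (gt_mem_nhds he)] with n hn z hz
    rw [dist_comm, dist_eq_norm]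
    exact (hdw n z hz).trans_lt hn
  have hwmem : w ∈ holoUnitBall r :=
    ⟨hunif.tendstoLocallyUniformlyOn.differentiableOn
      (Eventually.of_forall fun n => (hmem n).1) isOpen_ball,
      fun z hz => le_of_tendsto' (hw z hz).norm fun n => (hmem n).2 z hz⟩
  refine ⟨w, hwmem, fun z hz => ?_⟩
  have hTlim : Tendsto (fun n => f (n + 1) z) atTop (nhds (T w z)) := by
    rw [tendsto_iff_norm_sub_tendsto_zero]
    refine squeeze_zero (fun n => norm_nonneg _) (fun n => ?_) hpow
    have := hT _ (hmem n) _ hwmem _ (hdw n) z hz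
    rw [hsucc]
    have h0 : (0 : ℝ) ≤ (1 / 2) ^ n := by positivity
    linarith
  exact tendsto_nhds_unique hTlim ((tendsto_add_atTop_iff_nat 1).2 (hw z hz))

lemma norm_sub_le_half_of_norm_le {f : ℂ → ℂ} (hf : DifferentiableOn ℂ f (ball 0 3))
    (hb : ∀ u ∈ ball (0 : ℂ) 3, ‖f u‖ ≤ 1 / 2) {u v : ℂ} (hu : ‖u‖ ≤ 1) (hv : ‖v‖ ≤ 1) :
    ‖f u - f v‖ ≤ 1 / 2 * ‖u - v‖ := by
  have hsub : ∀ x ∈ closedBall (0 : ℂ) 1, closedBall x 1 ⊆ ball (0 : ℂ) 3 := by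
    intro x hx
    apply closedBall_subset_ball'
    rw [mem_closedBall] at hx
    linarith
  refine (convex_closedBall (0 : ℂ) 1).norm_image_sub_le_of_norm_deriv_le (𝕜 := ℂ)
    (f := f) (fun x hx => ?_) (fun x hx => ?_) (by simpa using hv) (by simpa using hu)
  · exact hf.differentiableAt (isOpen_ball.mem_nhds (hsub x hx (mem_closedBall_self zero_le_one)))
  · have := Complex.norm_deriv_le_of_forall_mem_sphere_norm_le (c := x) (R := 1) (C := 1 / 2)
      (f := f) one_pos (hf.diffContOnCl_ball (hsub x hx))
      fun y hy => hb y (hsub x hx (sphere_subset_closedBall hy))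
    simpa using this

/-- The integral operator whose fixed points solve `w z = H z (radialMean w z)`. -/
def meanOperator (H : ℂ → ℂ → ℂ) (w : ℂ → ℂ) (z : ℂ) : ℂ := H z (radialMean w z)

section meanOperator

variable {r : ℝ} {H : ℂ → ℂ → ℂ}

lemma mapsTo_meanOperator
    (hd : DifferentiableOn ℂ (fun p : ℂ × ℂ => H p.1 p.2) (ball 0 r ×ˢ ball 0 3))
    (hb : ∀ z ∈ ball (0 : ℂ) r, ∀ u ∈ ball (0 : ℂ) 3, ‖H z u‖ ≤ 1 / 2) :
    MapsTo (meanOperator H) (holoUnitBall r) (holoUnitBall r) := by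
  intro w hw
  have hm : ∀ z ∈ ball (0 : ℂ) r, radialMean w z ∈ ball (0 : ℂ) 3 := fun z hz => by
    have := norm_radialMean_le hw.2 hz
    rw [mem_ball_zero_iff]
    linarith
  refine ⟨?_, fun z hz => (hb z hz _ (hm z hz)).trans (by norm_num)⟩
  exact hd.comp (differentiableOn_id.prodMk (differentiableOn_radialMean hw.1))
    fun z hz => ⟨hz, hm z hz⟩

lemma halvesDistances_meanOperator
    (hd : DifferentiableOn ℂ (fun p : ℂ × ℂ => H p.1 p.2) (ball 0 r ×ˢ ball 0 3))
    (hb : ∀ z ∈ ball (0 : ℂ) r, ∀ u ∈ ball (0 : ℂ) 3, ‖H z u‖ ≤ 1 / 2) :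
    HalvesDistances r (meanOperator H) := by
  intro w hw v hv C hC z hz
  have h1 : DifferentiableOn ℂ (H z) (ball 0 3) :=
    hd.comp ((differentiableOn_const z).prodMk differentiableOn_id) fun u hu => ⟨hz, hu⟩
  have h2 := norm_sub_le_half_of_norm_le h1 (hb z hz) (norm_radialMean_le hw.2 hz)
    (norm_radialMean_le hv.2 hz)
  have h3 := norm_radialMean_sub_le hw.1.continuousOn hv.1.continuousOn hC hz
  simp only [meanOperator]
  linarith

end meanOperator

/-- Solutions of `w z = H z (radialMean w z) ε`, continuously dependent on `ε`. -/
lemma exists_continuous_family_fixedPoints {r e : ℝ} {H : ℂ → ℂ → ℝ → ℂ} (he : 0 < e)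
    (hd : ∀ ε, |ε| < e →
      DifferentiableOn ℂ (fun p : ℂ × ℂ => H p.1 p.2 ε) (ball 0 r ×ˢ ball 0 3))
    (hb : ∀ ε, |ε| < e → ∀ z ∈ ball (0 : ℂ) r, ∀ u ∈ ball (0 : ℂ) 3, ‖H z u ε‖ ≤ 1 / 2)
    (hc : ∀ ε₂, |ε₂| < e → ∀ z ∈ closedBall (0 : ℂ) r, ∀ u ∈ closedBall (0 : ℂ) 1,
      ContinuousAt (fun p : ℝ × ℂ × ℂ => H p.2.1 p.2.2 p.1) (ε₂, z, u))
    (h0 : ∀ z ∈ ball (0 : ℂ) r, H z 0 0 = 0) :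
    ∃ W : ℝ → ℂ → ℂ,
      (∀ ε, |ε| < e → W ε ∈ holoUnitBall r ∧
        ∀ z ∈ ball (0 : ℂ) r, W ε z = H z (radialMean (W ε) z) ε) ∧
      (∀ z ∈ ball (0 : ℂ) r, W 0 z = 0) ∧
      ∀ ε₂, |ε₂| < e → ∀ η : ℝ, 0 < η → ∃ ζ : ℝ, 0 < ζ ∧ ∀ ε, |ε| < e → |ε - ε₂| < ζ →
        ∀ z ∈ ball (0 : ℂ) r, ‖W ε z - W ε₂ z‖ ≤ η := by
  have hT := fun ε hε => halvesDistances_meanOperator (H := fun z u => H z u ε) (hd ε hε) (hb ε hε)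
  have hex : ∀ ε, ∃ w : ℂ → ℂ, |ε| < e → w ∈ holoUnitBall r ∧
      ∀ z ∈ ball (0 : ℂ) r, meanOperator (fun z u => H z u ε) w z = w z := by
    intro ε
    by_cases hε : |ε| < e
    · obtain ⟨w, hw⟩ := (hT ε hε).exists_fixedPoint (mapsTo_meanOperator (hd ε hε) (hb ε hε))
      exact ⟨w, fun _ => hw⟩
    · exact ⟨0, fun h => absurd h hε⟩
  choose W hW using hex
  refine ⟨W, fun ε hε => ⟨(hW ε hε).1, fun z hz => ((hW ε hε).2 z hz).symm⟩, ?_, ?_⟩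
  · intro z hz
    have he0 : |(0 : ℝ)| < e := by simpa using he
    have hzero : (0 : ℂ → ℂ) ∈ holoUnitBall r := ⟨differentiableOn_const 0, fun z _ => by simp⟩
    have := (hT 0 he0).norm_sub_le (η := 0) (hW 0 he0).1 hzero (hW 0 he0).2
      (fun x hx => by simp [meanOperator, radialMean, h0 x hx]) hz
    simpa using this
  · intro ε₂ hε₂ η hη
    have hev : ∀ᶠ ε in nhds ε₂, ∀ p ∈ closedBall (0 : ℂ) r ×ˢ closedBall (0 : ℂ) 1,
        ‖H p.1 p.2 ε - H p.1 p.2 ε₂‖ < η / 2 := by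
      refine ((isCompact_closedBall (0 : ℂ) r).prod
        (isCompact_closedBall (0 : ℂ) 1)).eventually_forall_of_forall_eventually
        fun p hp => ?_
      have hcp : ContinuousAt (fun q : ℝ × ℂ × ℂ => H q.2.1 q.2.2 q.1) (ε₂, p) :=
        hc ε₂ hε₂ p.1 hp.1 p.2 hp.2
      have hproj : ContinuousAt (fun q : ℝ × ℂ × ℂ => (ε₂, q.2)) (ε₂, p) := by fun_prop
      have hcp2 : ContinuousAt (fun q : ℝ × ℂ × ℂ => H q.2.1 q.2.2 ε₂) (ε₂, p) :=
        hcp.comp (x := (ε₂, p)) (f := fun q : ℝ × ℂ × ℂ => (ε₂, q.2)) hproj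
      have := (hcp.sub hcp2).norm
      have h2 : Tendsto (fun q : ℝ × ℂ × ℂ => ‖H q.2.1 q.2.2 q.1 - H q.2.1 q.2.2 ε₂‖)
          (nhds (ε₂, p)) (nhds 0) := by
        simpa [ContinuousAt] using this
      exact h2.eventually (gt_mem_nhds (half_pos hη))
    obtain ⟨ζ, hζ, hball⟩ := Metric.eventually_nhds_iff.1 hev
    refine ⟨ζ, hζ, fun ε hε hd' z hz => ?_⟩
    have := (hT ε hε).norm_sub_le (η := η / 2) (hW ε hε).1 (hW ε₂ hε₂).1 (hW ε hε).2
      (fun x hx => by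
        rw [← (hW ε₂ hε₂).2 x hx]
        refine (hball (by rwa [Real.dist_eq]) (x, radialMean (W ε₂) x)
          ⟨ball_subset_closedBall hx, ?_⟩).le
        simpa using norm_radialMean_le (hW ε₂ hε₂).1.2 hx) hz
    linarith

section blowUp

variable {k : ℕ} (α : Fin (k + 1) → ℝ → ℂ) (Q R : ℂ → ℂ → ℝ → ℂ) (g : ℂ → ℝ → ℂ)
  (i : Fin (k + 1))

/-- The product of the factors `t - α l ε` with `l ≠ i`. -/
def cofactor (t : ℂ) (ε : ℝ) : ℂ := ∏ l ∈ Finset.univ.erase i, (t - α l ε)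

/-- The `t`-component of the field along `t = α i ε + z * u`, divided by `z`. -/
def blowUpNumer (z u : ℂ) (ε : ℝ) : ℂ :=
  u * cofactor α i (α i ε + z * u) ε + R z (α i ε + z * u) ε

/-- The `z`-component of the field along `t = α i ε + z * u`, divided by `z`. -/
def blowUpDenom (z u : ℂ) (ε : ℝ) : ℂ :=
  1 + Q z (α i ε + z * u) ε + g (α i ε + z * u) ε * (u * cofactor α i (α i ε + z * u) ε)

lemma prod_eq_mul_cofactor (t : ℂ) (ε : ℝ) :
    ∏ l, (t - α l ε) = (t - α i ε) * cofactor α i t ε :=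
  (Finset.mul_prod_erase _ _ (Finset.mem_univ i)).symm

variable {α Q R g i}

lemma cofactor_zero (hk : 1 ≤ k) (hα0 : ∀ i, α i 0 = 0) : cofactor α i 0 0 = 0 := by
  obtain ⟨l, hl⟩ : ∃ l : Fin (k + 1), l ≠ i := by
    have : Nontrivial (Fin (k + 1)) := Fin.nontrivial_iff_two_le.2 (by omega)
    exact exists_ne i
  exact Finset.prod_eq_zero (Finset.mem_erase.2 ⟨hl, Finset.mem_univ l⟩) (by simp [hα0])

lemma continuousAt_comp_tripleMap {δ₀ ε₀ : ℝ} {S : ℂ → ℂ → ℝ → ℂ} {b : ℝ → ℂ}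
    (hSc : ContinuousOn (fun w : (ℂ × ℂ) × ℝ => S w.1.1 w.1.2 w.2)
      ((ball 0 δ₀ ×ˢ ball 0 δ₀) ×ˢ Ioo (-ε₀) ε₀))
    {ε : ℝ} {z u : ℂ} (hb : ContinuousAt b ε) (hz : z ∈ ball (0 : ℂ) δ₀)
    (hε : ε ∈ Ioo (-ε₀) ε₀) (ht : b ε + z * u ∈ ball (0 : ℂ) δ₀) :
    ContinuousAt (fun p : ℝ × ℂ × ℂ => S p.2.1 (b p.1 + p.2.1 * p.2.2) p.1) (ε, z, u) := by
  have hS : ContinuousAt (fun w : (ℂ × ℂ) × ℝ => S w.1.1 w.1.2 w.2) ((z, b ε + z * u), ε) :=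
    hSc.continuousAt (((isOpen_ball.prod isOpen_ball).prod isOpen_Ioo).mem_nhds ⟨⟨hz, ht⟩, hε⟩)
  have hb1 : ContinuousAt (fun p : ℝ × ℂ × ℂ => b p.1) (ε, z, u) :=
    ContinuousAt.comp (x := (ε, z, u)) (f := fun p : ℝ × ℂ × ℂ => p.1) (g := b) hb
      continuousAt_fst
  exact ContinuousAt.comp (x := (ε, z, u))
    (f := fun p : ℝ × ℂ × ℂ => ((p.2.1, b p.1 + p.2.1 * p.2.2), p.1)) hS (by fun_prop)

lemma continuousAt_cofactor {ε : ℝ} {z u : ℂ} (hα : ∀ i, ContinuousAt (α i) ε) :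
    ContinuousAt (fun p : ℝ × ℂ × ℂ => cofactor α i (α i p.1 + p.2.1 * p.2.2) p.1)
      (ε, z, u) := by
  have hα1 : ∀ l, ContinuousAt (fun p : ℝ × ℂ × ℂ => α l p.1) (ε, z, u) := fun l =>
    ContinuousAt.comp (x := (ε, z, u)) (f := fun p : ℝ × ℂ × ℂ => p.1) (g := α l) (hα l)
      continuousAt_fst
  unfold cofactor
  refine tendsto_finsetProd _ fun l _ => ?_
  exact ((hα1 i).add (by fun_prop)).sub (hα1 l)

lemma continuousAt_blowUpNumer {δ₀ ε₀ : ℝ}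
    (hRc : ContinuousOn (fun w : (ℂ × ℂ) × ℝ => R w.1.1 w.1.2 w.2)
      ((ball 0 δ₀ ×ˢ ball 0 δ₀) ×ˢ Ioo (-ε₀) ε₀))
    {ε : ℝ} {z u : ℂ} (hα : ∀ i, ContinuousAt (α i) ε) (hz : z ∈ ball (0 : ℂ) δ₀)
    (hε : ε ∈ Ioo (-ε₀) ε₀) (ht : α i ε + z * u ∈ ball (0 : ℂ) δ₀) :
    ContinuousAt (fun p : ℝ × ℂ × ℂ => blowUpNumer α R i p.2.1 p.2.2 p.1) (ε, z, u) :=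
  ((by fun_prop : ContinuousAt (fun p : ℝ × ℂ × ℂ => p.2.2) (ε, z, u)).mul
    (continuousAt_cofactor hα)).add (continuousAt_comp_tripleMap hRc (hα i) hz hε ht)

lemma continuousAt_blowUpDenom {δ₀ ε₀ : ℝ}
    (hQc : ContinuousOn (fun w : (ℂ × ℂ) × ℝ => Q w.1.1 w.1.2 w.2)
      ((ball 0 δ₀ ×ˢ ball 0 δ₀) ×ˢ Ioo (-ε₀) ε₀))
    (hgc : ContinuousOn (fun w : ℂ × ℝ => g w.1 w.2) (ball 0 δ₀ ×ˢ Ioo (-ε₀) ε₀))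
    {ε : ℝ} {z u : ℂ} (hα : ∀ i, ContinuousAt (α i) ε) (hz : z ∈ ball (0 : ℂ) δ₀)
    (hε : ε ∈ Ioo (-ε₀) ε₀) (ht : α i ε + z * u ∈ ball (0 : ℂ) δ₀) :
    ContinuousAt (fun p : ℝ × ℂ × ℂ => blowUpDenom α Q g i p.2.1 p.2.2 p.1) (ε, z, u) := by
  have hg : ContinuousOn (fun w : (ℂ × ℂ) × ℝ => g w.1.2 w.2)
      ((ball 0 δ₀ ×ˢ ball 0 δ₀) ×ˢ Ioo (-ε₀) ε₀) :=
    hgc.comp (f := fun w : (ℂ × ℂ) × ℝ => (w.1.2, w.2)) (by fun_prop)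
      fun w hw => ⟨hw.1.2, hw.2⟩
  have hg1 := continuousAt_comp_tripleMap (S := fun _ t ε => g t ε) hg (hα i) hz hε ht
  exact (continuousAt_const.add (continuousAt_comp_tripleMap hQc (hα i) hz hε ht)).add
    (hg1.mul ((by fun_prop : ContinuousAt (fun p : ℝ × ℂ × ℂ => p.2.2) (ε, z, u)).mul
      (continuousAt_cofactor hα)))

lemma differentiableAt_cofactor {ε : ℝ} {p : ℂ × ℂ} :
    DifferentiableAt ℂ (fun p : ℂ × ℂ => cofactor α i (α i ε + p.1 * p.2) ε) p := by
  unfold cofactor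
  fun_prop

lemma differentiableAt_comp_tripleMap {δ₀ : ℝ} {S : ℂ → ℂ → ℂ} {b : ℂ}
    (hS : DifferentiableOn ℂ (fun w : ℂ × ℂ => S w.1 w.2) (ball 0 δ₀ ×ˢ ball 0 δ₀))
    {p : ℂ × ℂ} (hz : p.1 ∈ ball (0 : ℂ) δ₀) (ht : b + p.1 * p.2 ∈ ball (0 : ℂ) δ₀) :
    DifferentiableAt ℂ (fun p : ℂ × ℂ => S p.1 (b + p.1 * p.2)) p :=
  DifferentiableAt.comp (g := fun w : ℂ × ℂ => S w.1 w.2)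
    (f := fun p : ℂ × ℂ => (p.1, b + p.1 * p.2)) p
    (hS.differentiableAt ((isOpen_ball.prod isOpen_ball).mem_nhds ⟨hz, ht⟩)) (by fun_prop)

lemma differentiableAt_blowUpNumer {δ₀ ε : ℝ}
    (hR : DifferentiableOn ℂ (fun w : ℂ × ℂ => R w.1 w.2 ε) (ball 0 δ₀ ×ˢ ball 0 δ₀))
    {p : ℂ × ℂ} (hz : p.1 ∈ ball (0 : ℂ) δ₀) (ht : α i ε + p.1 * p.2 ∈ ball (0 : ℂ) δ₀) :
    DifferentiableAt ℂ (fun p : ℂ × ℂ => blowUpNumer α R i p.1 p.2 ε) p :=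
  (differentiableAt_snd.mul differentiableAt_cofactor).add
    (differentiableAt_comp_tripleMap (S := fun z t => R z t ε) hR hz ht)

lemma differentiableAt_blowUpDenom {δ₀ ε : ℝ}
    (hQ : DifferentiableOn ℂ (fun w : ℂ × ℂ => Q w.1 w.2 ε) (ball 0 δ₀ ×ˢ ball 0 δ₀))
    (hg : DifferentiableOn ℂ (fun t => g t ε) (ball 0 δ₀))
    {p : ℂ × ℂ} (hz : p.1 ∈ ball (0 : ℂ) δ₀) (ht : α i ε + p.1 * p.2 ∈ ball (0 : ℂ) δ₀) :
    DifferentiableAt ℂ (fun p : ℂ × ℂ => blowUpDenom α Q g i p.1 p.2 ε) p := by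
  have hg1 : DifferentiableOn ℂ (fun w : ℂ × ℂ => g w.2 ε) (ball 0 δ₀ ×ˢ ball 0 δ₀) :=
    hg.comp (f := fun w : ℂ × ℂ => w.2) differentiableOn_snd fun w hw => hw.2
  exact ((differentiableAt_const 1).add
    (differentiableAt_comp_tripleMap (S := fun z t => Q z t ε) hQ hz ht)).add
    ((differentiableAt_comp_tripleMap (S := fun _ t => g t ε) hg1 hz ht).mul
      (differentiableAt_snd.mul differentiableAt_cofactor))

/-- The blown-up field is a small perturbation of `(1, 0)` near `z = 0`, `ε = 0`. -/
lemma eventually_blowUp_small {δ₀ ε₀ : ℝ} (hk : 1 ≤ k) (hε₀ : 0 < ε₀) (hδ₀ : 0 < δ₀)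
    (hαc : ∀ i, ContinuousAt (α i) 0) (hα0 : ∀ i, α i 0 = 0)
    (hQc : ContinuousOn (fun w : (ℂ × ℂ) × ℝ => Q w.1.1 w.1.2 w.2)
      ((ball 0 δ₀ ×ˢ ball 0 δ₀) ×ˢ Ioo (-ε₀) ε₀))
    (hRc : ContinuousOn (fun w : (ℂ × ℂ) × ℝ => R w.1.1 w.1.2 w.2)
      ((ball 0 δ₀ ×ˢ ball 0 δ₀) ×ˢ Ioo (-ε₀) ε₀))
    (hgc : ContinuousOn (fun w : ℂ × ℝ => g w.1 w.2) (ball 0 δ₀ ×ˢ Ioo (-ε₀) ε₀))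
    (hQ0 : Q 0 0 0 = 0) (hR0 : R 0 0 0 = 0) :
    ∀ᶠ x : ℝ × ℂ in nhds (0, 0), ∀ u ∈ closedBall (0 : ℂ) 3,
      α i x.1 + x.2 * u ∈ ball (0 : ℂ) δ₀ ∧ ‖blowUpNumer α R i x.2 u x.1‖ < 1 / 4 ∧
        1 / 2 < ‖blowUpDenom α Q g i x.2 u x.1‖ := by
  refine (isCompact_closedBall (0 : ℂ) 3).eventually_forall_of_forall_eventually fun u _ => ?_
  have hassoc : ContinuousAt (fun q : (ℝ × ℂ) × ℂ => (q.1.1, q.1.2, q.2)) ((0, 0), u) := by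
    fun_prop
  have h0 : (0 : ℝ) ∈ Ioo (-ε₀) ε₀ := by simpa using hε₀
  have hz0 : (0 : ℂ) ∈ ball (0 : ℂ) δ₀ := mem_ball_self hδ₀
  have ht0 : α i 0 + 0 * u ∈ ball (0 : ℂ) δ₀ := by simpa [hα0] using hδ₀
  have hαf : ContinuousAt (fun p : ℝ × ℂ × ℂ => α i p.1) (0, 0, u) :=
    ContinuousAt.comp (x := ((0 : ℝ), (0 : ℂ), u)) (f := fun p : ℝ × ℂ × ℂ => p.1) (g := α i)
      (hαc i) continuousAt_fst
  have htc : ContinuousAt (fun p : ℝ × ℂ × ℂ => α i p.1 + p.2.1 * p.2.2) (0, 0, u) :=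
    hαf.add (by fun_prop)
  have hN := (continuousAt_blowUpNumer hRc hαc hz0 h0 ht0).norm
  have hD := (continuousAt_blowUpDenom hQc hgc hαc hz0 h0 ht0).norm
  have e1 := htc.eventually (isOpen_ball.mem_nhds ht0)
  have e2 := hN.tendsto.eventually_lt_const (u := 1 / 4)
    (by simp [blowUpNumer, hα0, cofactor_zero hk hα0, hR0])
  have e3 := hD.tendsto.eventually_const_lt (u := 1 / 2)
    (by simp only [blowUpDenom, hα0, cofactor_zero hk hα0, hQ0, zero_mul, add_zero, mul_zero,
          norm_one]; norm_num)
  exact hassoc.eventually (e1.and (e2.and e3))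

end blowUp

theorem stmt13 (k : ℕ) (hk : 1 ≤ k) (ε₀ δ₀ : ℝ) (hε₀ : 0 < ε₀) (hδ₀ : 0 < δ₀)
    (α : Fin (k + 1) → ℝ → ℂ)
    (Q R : ℂ → ℂ → ℝ → ℂ) (g : ℂ → ℝ → ℂ)
    (hαc : ∀ i, ContinuousOn (α i) (Set.Ioo (-ε₀) ε₀))
    (hα0 : ∀ i, α i 0 = 0)
    (hQhol : ∀ ε ∈ Set.Ioo (-ε₀) ε₀, DifferentiableOn ℂ
      (fun zt : ℂ × ℂ => Q zt.1 zt.2 ε) (Metric.ball 0 δ₀ ×ˢ Metric.ball 0 δ₀))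
    (hRhol : ∀ ε ∈ Set.Ioo (-ε₀) ε₀, DifferentiableOn ℂ
      (fun zt : ℂ × ℂ => R zt.1 zt.2 ε) (Metric.ball 0 δ₀ ×ˢ Metric.ball 0 δ₀))
    (hghol : ∀ ε ∈ Set.Ioo (-ε₀) ε₀, DifferentiableOn ℂ (fun t => g t ε) (Metric.ball 0 δ₀))
    (hQc : ContinuousOn (fun w : (ℂ × ℂ) × ℝ => Q w.1.1 w.1.2 w.2)
      ((Metric.ball 0 δ₀ ×ˢ Metric.ball 0 δ₀) ×ˢ Set.Ioo (-ε₀) ε₀))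
    (hRc : ContinuousOn (fun w : (ℂ × ℂ) × ℝ => R w.1.1 w.1.2 w.2)
      ((Metric.ball 0 δ₀ ×ˢ Metric.ball 0 δ₀) ×ˢ Set.Ioo (-ε₀) ε₀))
    (hgc : ContinuousOn (fun w : ℂ × ℝ => g w.1 w.2) (Metric.ball 0 δ₀ ×ˢ Set.Ioo (-ε₀) ε₀))
    (hQ0 : Q 0 0 0 = 0)
    (hR0 : ∀ z t : ℂ, R z t 0 = 0) :
    ∃ ε₁ δz δt : ℝ, 0 < ε₁ ∧ ε₁ ≤ ε₀ ∧ 0 < δz ∧ 0 < δt ∧ δz ≤ δ₀ ∧ δt ≤ δ₀ ∧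
    ∃ Fa : Fin (k + 1) → ℝ → ℂ → ℂ,
      (∀ (i : Fin (k + 1)) (ε : ℝ), |ε| < ε₁ →
        DifferentiableOn ℂ (Fa i ε) (Metric.ball 0 δz) ∧
        Fa i ε 0 = α i ε ∧
        (∀ z ∈ Metric.ball (0 : ℂ) δz, Fa i ε z ∈ Metric.ball (0 : ℂ) δt) ∧
        (∀ z ∈ Metric.ball (0 : ℂ) δz,
          deriv (Fa i ε) z *
              (z * (1 + Q z (Fa i ε z) ε) + g (Fa i ε z) ε * ∏ l, (Fa i ε z - α l ε))
            = (∏ l, (Fa i ε z - α l ε)) + z * R z (Fa i ε z) ε) ∧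
        (∀ z ∈ Metric.ball (0 : ℂ) δz, ‖deriv (Fa i ε) z‖ ≤ 1 ∧ ‖Fa i ε z - α i ε‖ ≤ ‖z‖)) ∧
      (∀ (i : Fin (k + 1)) (z : ℂ), z ∈ Metric.ball (0 : ℂ) δz → Fa i 0 z = 0) ∧
      ∀ (i : Fin (k + 1)) (ε₂ : ℝ), |ε₂| < ε₁ → ∀ K : Set ℂ, IsCompact K →
        K ⊆ Metric.ball (0 : ℂ) δz → ∀ η : ℝ, 0 < η → ∃ ζ : ℝ, 0 < ζ ∧
          ∀ ε : ℝ, |ε| < ε₁ → |ε - ε₂| < ζ → ∀ z ∈ K, ‖Fa i ε z - Fa i ε₂ z‖ ≤ η := by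
  have hαc' : ∀ ε : ℝ, |ε| < ε₀ → ∀ i, ContinuousAt (α i) ε := fun ε hε i =>
    (hαc i).continuousAt (isOpen_Ioo.mem_nhds (abs_lt.1 hε))
  have hsmall := Filter.eventually_all.2 fun i => eventually_blowUp_small (i := i) hk hε₀ hδ₀
    (hαc' 0 (by simpa using hε₀)) hα0 hQc hRc hgc hQ0 (hR0 0 0)
  obtain ⟨ρ, hρ, hρs⟩ := Metric.eventually_nhds_iff.1 hsmall
  obtain ⟨r, hr, hrm⟩ : ∃ r : ℝ, 0 < r ∧ r < min ρ (min ε₀ δ₀) :=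
    exists_between (lt_min hρ (lt_min hε₀ hδ₀))
  obtain ⟨hrρ, hrε, hrδ⟩ : r < ρ ∧ r < ε₀ ∧ r < δ₀ := by simpa using hrm
  have hgood : ∀ i, ∀ ε : ℝ, |ε| < r → ∀ z ∈ closedBall (0 : ℂ) r, ∀ u ∈ closedBall (0 : ℂ) 3,
      α i ε + z * u ∈ ball (0 : ℂ) δ₀ ∧ ‖blowUpNumer α R i z u ε‖ < 1 / 4 ∧
        1 / 2 < ‖blowUpDenom α Q g i z u ε‖ := by
    intro i ε hε z hz u hu
    refine hρs (y := (ε, z)) ?_ i u hu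
    rw [mem_closedBall_zero_iff] at hz
    rw [Prod.dist_eq, max_lt_iff, Real.dist_eq, sub_zero, dist_zero_right]
    exact ⟨hε.trans hrρ, hz.trans_lt hrρ⟩
  have hne : ∀ i, ∀ ε : ℝ, |ε| < r → ∀ z ∈ closedBall (0 : ℂ) r, ∀ u ∈ closedBall (0 : ℂ) 3,
      blowUpDenom α Q g i z u ε ≠ 0 := fun i ε hε z hz u hu => by
    have := (hgood i ε hε z hz u hu).2.2
    exact norm_pos_iff.1 (by linarith)
  have hzδ : closedBall (0 : ℂ) r ⊆ ball 0 δ₀ := closedBall_subset_ball hrδ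
  have hfam := fun i => exists_continuous_family_fixedPoints (r := r) (e := r)
    (H := fun z u ε => blowUpNumer α R i z u ε / blowUpDenom α Q g i z u ε) hr
    (fun ε hε p hp => by
      have hp1 := ball_subset_closedBall hp.1
      have hp2 := ball_subset_closedBall hp.2
      have hε' : ε ∈ Ioo (-ε₀) ε₀ := abs_lt.1 (hε.trans hrε)
      have ht := (hgood i ε hε p.1 hp1 p.2 hp2).1
      have hN := differentiableAt_blowUpNumer (hRhol ε hε') (hzδ hp1) ht
      have hD := differentiableAt_blowUpDenom (hQhol ε hε') (hghol ε hε') (hzδ hp1) ht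
      simp only [div_eq_mul_inv]
      exact (hN.mul (hD.inv (hne i ε hε p.1 hp1 p.2 hp2))).differentiableWithinAt)
    (fun ε hε z hz u hu => by
      obtain ⟨-, hN, hD⟩ := hgood i ε hε z (ball_subset_closedBall hz) u (ball_subset_closedBall hu)
      rw [norm_div, div_le_iff₀ (by linarith)]
      linarith)
    (fun ε hε z hz u hu => by
      have hu' : u ∈ closedBall (0 : ℂ) 3 := closedBall_subset_closedBall (by norm_num) hu
      have hε' : ε ∈ Ioo (-ε₀) ε₀ := abs_lt.1 (hε.trans hrε)
      have hα' := hαc' ε (hε.trans hrε)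
      have ht := (hgood i ε hε z hz u hu').1
      exact (continuousAt_blowUpNumer hRc hα' (hzδ hz) hε' ht).div
        (continuousAt_blowUpDenom hQc hgc hα' (hzδ hz) hε' ht) (hne i ε hε z hz u hu'))
    (fun z _ => by simp [blowUpNumer, hR0])
  choose W hW hW0 hWc using hfam
  refine ⟨r, r, δ₀, hr, hrε.le, hr, hδ₀, hrδ.le, le_rfl,
    fun i ε z => α i ε + z * radialMean (W i ε) z, fun i ε hε => ?_, fun i z hz => ?_,
    fun i ε₂ hε₂ K _ hKr η hη => ?_⟩
  · obtain ⟨⟨hWd, hWb⟩, hWeq⟩ := hW i ε hε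
    have hder : ∀ z ∈ ball (0 : ℂ) r,
        HasDerivAt (fun z => α i ε + z * radialMean (W i ε) z) (W i ε z) z := fun z hz =>
      (hasDerivAt_mul_radialMean hWd hz).const_add _
    have hm : ∀ z ∈ ball (0 : ℂ) r, radialMean (W i ε) z ∈ closedBall (0 : ℂ) 3 := fun z hz => by
      rw [mem_closedBall_zero_iff]
      exact (norm_radialMean_le hWb hz).trans (by norm_num)
    refine ⟨fun z hz => (hder z hz).differentiableAt.differentiableWithinAt, by simp,
      fun z hz => (hgood i ε hε z (ball_subset_closedBall hz) _ (hm z hz)).1,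
      fun z hz => ?_, fun z hz => ⟨?_, ?_⟩⟩
    · have hD := hne i ε hε z (ball_subset_closedBall hz) _ (hm z hz)
      have heq := (eq_div_iff hD).1 (hWeq z hz)
      rw [(hder z hz).deriv, prod_eq_mul_cofactor α i]
      simp only [blowUpNumer, blowUpDenom] at heq
      linear_combination z * heq
    · rw [(hder z hz).deriv]
      exact hWb z hz
    · rw [add_sub_cancel_left, norm_mul]
      exact mul_le_of_le_one_right (norm_nonneg z) (norm_radialMean_le hWb hz)
  · have := norm_radialMean_le (w := W i 0) (C := 0)
      (fun x hx => by simp [hW0 i x hx]) hz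
    simp [hα0, norm_le_zero_iff.1 this]
  · obtain ⟨ζ, hζ, hWζ⟩ := hWc i ε₂ hε₂ (η / (2 * r)) (by positivity)
    obtain ⟨ξ, hξ, hαξ⟩ := Metric.continuousAt_iff.1 (hαc' ε₂ (hε₂.trans hrε) i) (η / 2)
      (half_pos hη)
    refine ⟨min ζ ξ, lt_min hζ hξ, fun ε hε hd z hz => ?_⟩
    have hzr := hKr hz
    have h1 := norm_radialMean_sub_le (hW i ε hε).1.1.continuousOn
      (hW i ε₂ hε₂).1.1.continuousOn (hWζ ε hε (hd.trans_le (min_le_left _ _))) hzr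
    have h2 := hαξ (x := ε) (by rw [Real.dist_eq]; exact hd.trans_le (min_le_right _ _))
    rw [dist_eq_norm] at h2
    rw [mem_ball_zero_iff] at hzr
    calc ‖α i ε + z * radialMean (W i ε) z - (α i ε₂ + z * radialMean (W i ε₂) z)‖
        = ‖(α i ε - α i ε₂) + z * (radialMean (W i ε) z - radialMean (W i ε₂) z)‖ := by
          congr 1; ring
      _ ≤ ‖α i ε - α i ε₂‖ + ‖z‖ * ‖radialMean (W i ε) z - radialMean (W i ε₂) z‖ := by
          rw [← norm_mul]; exact norm_add_le _ _
      _ ≤ η / 2 + r * (η / (2 * r)) := by gcongr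
      _ = η := by field_simp; ring
end
end

section
/- Consider, for ε ∈ (−ε₀, ε₀), a family ẏ = G(y,t,ε), ṫ = F(y,t,ε) of holomorphic vector fields near 0 in ℂ^{n−1} × ℂ, continuous in ε, with singular points (0, α_i(ε)), i = 0, …, k, where the α_i are continuous with α_i(0) = 0; set p(t,ε) = ∏_i(t − α_i(ε)). Assume G(y,t,ε) = By + R₁(y,t,ε) + R₂(y,t,ε) and F(y,t,ε) = p(t,ε) + R₃(y,t,ε), where B is an invertible (n−1)×(n−1) complex matrix, ‖R₁(y,t,ε)‖/‖y‖ → 0 and |R₃(y,t,ε)|/‖y‖ → 0 as (y,t,ε) → 0 with y ≠ 0, and ‖R₂(y,t,ε)‖ ≤ C·|p(t,ε)| on a neighborhood of 0. Fix a continuous singularity family α(ε) = α_j(ε) and define K_ε = {(y,t) : ‖y‖ ≤ |t − α(ε)| and ‖G(y,t,ε)‖ ≤ |F(y,t,ε)|} ∖ {(0, α_i(ε)) : 0 ≤ i ≤ k}. Then for every σ > 0 there exist a neighborhood U of 0 in ℂ^{n−1} × ℂ and ε₁ > 0 such that for all |ε| < ε₁ and all (y,t) ∈ K_ε ∩ U: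 |F(y,t,ε) − p(t,ε)| ≤ σ·|p(t,ε)|. Equivalently, on K_ε ∩ U the vector field (G, F) differs from the proportional field (G·p/F, p) — the vector in the same complex tangent line whose t-component equals p(t,ε) — by at most σ times the norm of the latter. -/
noncomputable section

open Complex Set Filter Metric

/-- An invertible complex matrix is bounded below on the space it acts on. -/
theorem exists_norm_le_mul_norm_mulVec {m : ℕ} {B : Matrix (Fin m) (Fin m) ℂ} (hB : IsUnit B) :
    ∃ D : ℝ, 0 < D ∧ ∀ y : Fin m → ℂ, ‖y‖ ≤ D * ‖B.mulVec y‖ := by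
  obtain ⟨D, hD, h⟩ := (LinearMap.toContinuousLinearMap (Matrix.mulVecLin B⁻¹)).bound
  refine ⟨D, hD, fun y => ?_⟩
  have hinv : B⁻¹.mulVec (B.mulVec y) = y := by
    rw [Matrix.mulVec_mulVec, Matrix.nonsing_inv_mul B ((Matrix.isUnit_iff_isUnit_det B).1 hB),
      Matrix.one_mulVec]
  simpa [hinv] using h (B.mulVec y)

theorem stmt14 (m k : ℕ) (hm : 1 ≤ m) (hk : 1 ≤ k) (ε₀ ρ₄ : ℝ) (hε₀ : 0 < ε₀) (hρ₄ : 0 < ρ₄)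
    (B : Matrix (Fin m) (Fin m) ℂ) (hB : IsUnit B)
    (G R₁ R₂ : (Fin m → ℂ) → ℂ → ℝ → (Fin m → ℂ))
    (F R₃ : (Fin m → ℂ) → ℂ → ℝ → ℂ)
    (α : Fin (k + 1) → ℝ → ℂ)
    (hαc : ∀ i, ContinuousOn (α i) (Set.Ioo (-ε₀) ε₀))
    (hα0 : ∀ i, α i 0 = 0)
    (hhol : ∀ ε ∈ Set.Ioo (-ε₀) ε₀, DifferentiableOn ℂ
      (fun p : (Fin m → ℂ) × ℂ => (G p.1 p.2 ε, F p.1 p.2 ε))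
      (Metric.ball 0 ρ₄ ×ˢ Metric.ball 0 ρ₄))
    (hcont : ContinuousOn
      (fun w : ((Fin m → ℂ) × ℂ) × ℝ => (G w.1.1 w.1.2 w.2, F w.1.1 w.1.2 w.2))
      ((Metric.ball 0 ρ₄ ×ˢ Metric.ball 0 ρ₄) ×ˢ Set.Ioo (-ε₀) ε₀))
    (hsing : ∀ ε ∈ Set.Ioo (-ε₀) ε₀, ∀ i, G 0 (α i ε) ε = 0 ∧ F 0 (α i ε) ε = 0)
    (hG : ∀ y t ε, G y t ε = B.mulVec y + R₁ y t ε + R₂ y t ε)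
    (hF : ∀ y t ε, F y t ε = (∏ i, (t - α i ε)) + R₃ y t ε)
    (hR₁ : ∀ η : ℝ, 0 < η → ∃ ρ : ℝ, 0 < ρ ∧ ∀ y t ε, ‖y‖ < ρ → ‖t‖ < ρ → |ε| < ρ →
      ‖R₁ y t ε‖ ≤ η * ‖y‖)
    (hR₃ : ∀ η : ℝ, 0 < η → ∃ ρ : ℝ, 0 < ρ ∧ ∀ y t ε, ‖y‖ < ρ → ‖t‖ < ρ → |ε| < ρ →
      ‖R₃ y t ε‖ ≤ η * ‖y‖)
    (hR₂ : ∃ C ρ : ℝ, 0 < C ∧ 0 < ρ ∧ ∀ y t ε, ‖y‖ < ρ → ‖t‖ < ρ → |ε| < ρ →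
      ‖R₂ y t ε‖ ≤ C * ‖∏ i, (t - α i ε)‖)
    (j : Fin (k + 1)) :
    ∀ σ : ℝ, 0 < σ → ∃ ρu ε₁ : ℝ, 0 < ρu ∧ 0 < ε₁ ∧
      ∀ ε : ℝ, |ε| < ε₁ → ∀ (y : Fin m → ℂ) (t : ℂ),
        ‖y‖ < ρu → ‖t‖ < ρu →
        ‖y‖ ≤ ‖t - α j ε‖ → ‖G y t ε‖ ≤ ‖F y t ε‖ →
        (∀ i, (y, t) ≠ ((0 : Fin m → ℂ), α i ε)) →
        ‖F y t ε - ∏ i, (t - α i ε)‖ ≤ σ * ‖∏ i, (t - α i ε)‖ := by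
  intro σ hσ
  obtain ⟨D, hD, hBD⟩ := exists_norm_le_mul_norm_mulVec hB
  obtain ⟨C, ρ₂, hC, hρ₂, h₂⟩ := hR₂
  obtain ⟨η, hη, hηD, hησ⟩ : ∃ η : ℝ, 0 < η ∧ η * (4 * D) ≤ 1 ∧ η * (2 * D * (1 + C)) ≤ σ := by
    refine ⟨min (1 / (4 * D)) (σ / (2 * D * (1 + C))), by positivity, ?_, ?_⟩
    · rw [← le_div_iff₀ (by positivity)]
      exact min_le_left _ _
    · rw [← le_div_iff₀ (by positivity)]
      exact min_le_right _ _
  obtain ⟨ρ₁, hρ₁, h₁⟩ := hR₁ η hη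
  obtain ⟨ρ₃, hρ₃, h₃⟩ := hR₃ η hη
  refine ⟨min ρ₁ (min ρ₂ ρ₃), min ρ₁ (min ρ₂ ρ₃), by positivity, by positivity, ?_⟩
  intro ε hε y t hy ht _ hGF _
  simp only [lt_min_iff] at hε hy ht
  have b₁ := h₁ y t ε hy.1 ht.1 hε.1
  have b₂ := h₂ y t ε hy.2.1 ht.2.1 hε.2.1
  have b₃ := h₃ y t ε hy.2.2 ht.2.2 hε.2.2
  have hF' := hF y t ε
  have hBy : B.mulVec y = G y t ε - R₁ y t ε - R₂ y t ε := by
    rw [hG]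
    abel
  set p := ∏ i, (t - α i ε)
  have hFp : ‖F y t ε‖ ≤ ‖p‖ + ‖R₃ y t ε‖ := hF' ▸ norm_add_le _ _
  have hBn : ‖B.mulVec y‖ ≤ (1 + C) * ‖p‖ + 2 * η * ‖y‖ := by
    have hsub₁ := norm_sub_le (G y t ε - R₁ y t ε) (R₂ y t ε)
    have hsub₂ := norm_sub_le (G y t ε) (R₁ y t ε)
    rw [hBy]
    linarith
  have hy_le : ‖y‖ ≤ 2 * D * (1 + C) * ‖p‖ := by
    have hlow := (hBD y).trans (mul_le_mul_of_nonneg_left hBn hD.le)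
    have habsorb := mul_le_mul_of_nonneg_right hηD (norm_nonneg y)
    linarith
  calc ‖F y t ε - p‖ = ‖R₃ y t ε‖ := by rw [hF', add_sub_cancel_left]
    _ ≤ η * ‖y‖ := b₃
    _ ≤ η * (2 * D * (1 + C) * ‖p‖) := by gcongr
    _ = η * (2 * D * (1 + C)) * ‖p‖ := by ring
    _ ≤ σ * ‖p‖ := by gcongr
end
end

section
/- Let k ≥ 1 and l ≥ 1 be integers, δ > 0, and let S = {ρe^{iφ} : 0 < ρ < δ, φ ∈ (a, b)} be an open sector such that there exists φ₀ ∈ (a, b) with cos(kφ₀) < 0. If g : S → ℂ is holomorphic, bounded, and satisfies g′(t) = (l/t^{k+1})·g(t) for all t ∈ S, then g ≡ 0 on S. -/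
noncomputable section

open Complex Set Filter Metric

/-- The open radial sector of directions strictly between `a` and `b`. -/
def Sector (a b : ℝ) : Set ℂ :=
  {z | ∃ ρ φ : ℝ, 0 < ρ ∧ a < φ ∧ φ < b ∧ z = ρ * Complex.exp (φ * Complex.I)}

/-- The sector truncated at radius `r`. -/
def SectorR (a b r : ℝ) : Set ℂ := Sector a b ∩ Metric.ball 0 r

open Topology

/-- The half-strip that the exponential maps onto the truncated sector. -/
def logStrip (a b δ : ℝ) : Set ℂ := {w | a < w.im ∧ w.im < b ∧ w.re < Real.log δ}

theorem convex_logStrip (a b δ : ℝ) : Convex ℝ (logStrip a b δ) :=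
  (convex_halfSpace_im_gt a).inter ((convex_halfSpace_im_lt b).inter (convex_halfSpace_re_lt _))

theorem exp_mem_SectorR {a b δ : ℝ} (hδ : 0 < δ) {w : ℂ} (hw : w ∈ logStrip a b δ) :
    exp w ∈ SectorR a b δ := by
  obtain ⟨ha, hb, hr⟩ := hw
  refine ⟨⟨Real.exp w.re, w.im, Real.exp_pos _, ha, hb, ?_⟩, ?_⟩
  · rw [ofReal_exp, ← Complex.exp_add, re_add_im]
  · rw [mem_ball_zero_iff, norm_exp]
    exact (Real.lt_log_iff_exp_lt hδ).1 hr

theorem exists_exp_eq_of_mem_SectorR {a b δ : ℝ} {t : ℂ} (ht : t ∈ SectorR a b δ) :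
    ∃ w ∈ logStrip a b δ, exp w = t := by
  obtain ⟨⟨ρ, φ, hρ, ha, hb, rfl⟩, hr⟩ := ht
  rw [mem_ball_zero_iff, norm_mul, norm_exp_ofReal_mul_I, mul_one, norm_real,
    Real.norm_of_nonneg hρ.le] at hr
  refine ⟨Real.log ρ + φ * I, ⟨by simpa using ha, by simpa using hb, ?_⟩, ?_⟩
  · simpa using Real.log_lt_log hρ hr
  · rw [Complex.exp_add, ← ofReal_exp, Real.exp_log hρ]

/-- In the logarithmic coordinate, a solution of `deriv g t = (l / t ^ (k + 1)) * g t` times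
`exp (l / (k t ^ k))` has zero derivative. -/
theorem hasDerivAt_exp_mul_exp {k : ℕ} (hk : k ≠ 0) (l : ℂ) {g : ℂ → ℂ} {w : ℂ}
    (h : HasDerivAt g ((l / exp w ^ (k + 1)) * g (exp w)) (exp w)) :
    HasDerivAt (fun w => g (exp w) * exp (l / k * exp (-(k * w)))) 0 w := by
  have hk' : (k : ℂ) ≠ 0 := Nat.cast_ne_zero.2 hk
  have h₁ := h.comp w (hasDerivAt_exp w)
  have h₂ := ((((hasDerivAt_id w).const_mul (k : ℂ)).neg.cexp).const_mul (l / k)).cexp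
  refine (h₁.mul h₂).congr_deriv ?_
  have he : exp (-(k * w)) = (exp w ^ k)⁻¹ := by rw [Complex.exp_neg, Complex.exp_nat_mul]
  have hw := exp_ne_zero w
  simp only [id, Function.comp_apply, Pi.neg_apply, he, pow_succ]
  field_simp
  ring

theorem tendsto_norm_exp_mul_exp_atBot {k : ℕ} (hk : 0 < k) {l : ℝ} (hl : 0 < l) {φ : ℝ}
    (hcos : Real.cos (k * φ) < 0) :
    Tendsto (fun s : ℝ => ‖exp ((l : ℂ) / k * exp (-(k * (s + φ * I))))‖) atBot (𝓝 0) := by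
  have hk' : (0 : ℝ) < k := Nat.cast_pos.2 hk
  have h (s : ℝ) : ‖exp ((l : ℂ) / k * exp (-(k * (s + φ * I))))‖ =
      Real.exp (l / k * Real.cos (k * φ) * Real.exp (-(k * s))) := by
    have hlk : (l : ℂ) / k = ((l / k : ℝ) : ℂ) := by push_cast; rfl
    rw [norm_exp, hlk, re_ofReal_mul, exp_re]
    simp
    ring
  simp only [h]
  refine Real.tendsto_exp_atBot.comp (Tendsto.const_mul_atTop_of_neg
    (mul_neg_of_pos_of_neg (div_pos hl hk') hcos) (Real.tendsto_exp_atTop.comp ?_))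
  exact tendsto_neg_atBot_atTop.comp (tendsto_id.const_mul_atBot hk')

theorem stmt16 (k l : ℕ) (hk : 1 ≤ k) (hl : 1 ≤ l) (δ a b : ℝ) (hδ : 0 < δ)
    (φ₀ : ℝ) (hφ₀ : φ₀ ∈ Set.Ioo a b) (hcos : Real.cos (k * φ₀) < 0)
    (g : ℂ → ℂ)
    (hg : DifferentiableOn ℂ g (SectorR a b δ))
    (hbd : ∃ M : ℝ, ∀ t ∈ SectorR a b δ, ‖g t‖ ≤ M)
    (hode : ∀ t ∈ SectorR a b δ, HasDerivAt g (((l : ℂ) / t ^ (k + 1)) * g t) t) :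
    ∀ t ∈ SectorR a b δ, g t = 0 := by
  intro t ht
  obtain ⟨M, hM⟩ := hbd
  obtain ⟨w, hw, rfl⟩ := exists_exp_eq_of_mem_SectorR ht
  set G : ℂ → ℂ := fun w => g (exp w) * exp (l / k * exp (-(k * w))) with hG
  have hconst (v : ℂ) (hv : v ∈ logStrip a b δ) : G v = G w := by
    have := (convex_logStrip a b δ).norm_image_sub_le_of_norm_hasDerivWithin_le (C := 0)
      (fun z hz => (hasDerivAt_exp_mul_exp (Nat.one_le_iff_ne_zero.1 hk) l
        (hode _ (exp_mem_SectorR hδ hz))).hasDerivWithinAt) (fun _ _ => norm_zero.le) hw hv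
    rw [zero_mul] at this
    exact sub_eq_zero.1 (norm_le_zero_iff.1 this)
  have hlim := (tendsto_norm_exp_mul_exp_atBot hk (Nat.cast_pos.2 hl) hcos).const_mul M
  rw [mul_zero] at hlim
  have hle : ‖G w‖ ≤ 0 := by
    refine ge_of_tendsto hlim ?_
    filter_upwards [eventually_lt_atBot (Real.log δ)] with s hs
    have hv : (s + φ₀ * I : ℂ) ∈ logStrip a b δ :=
      ⟨by simpa using hφ₀.1, by simpa using hφ₀.2, by simpa using hs⟩
    rw [← hconst _ hv, hG, norm_mul, ofReal_natCast]
    exact mul_le_mul_of_nonneg_right (hM _ (exp_mem_SectorR hδ hv)) (norm_nonneg _)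
  exact (mul_eq_zero.1 (norm_le_zero_iff.1 hle)).resolve_right (exp_ne_zero _)
end
end

section
/- Let k ≥ 1, a ∈ ℂ∖{0} and α ∈ ℂ∖{0}, and consider the polynomial vector field w(t) = a·(t^{k+1} − α^{k+1}) in ℂ, whose singular points α·e^{2πij/(k+1)}, j = 0, …, k, form a regular (k+1)-gon centered at 0, and whose multiplier at the singular point α is w′(α) = (k+1)·a·α^k. Suppose this multiplier is purely imaginary (α is a center-type singularity). Then at every point of the radial line through α the vector of the field is orthogonal to that line: for every s ∈ ℝ, Re( conj(α) · a·((sα)^{k+1} − α^{k+1}) ) = 0. -/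
noncomputable section

open Complex

theorem stmt19 (k : ℕ) (hk : 1 ≤ k) (a α : ℂ) (ha : a ≠ 0) (hα : α ≠ 0)
    (hmult : (((k : ℂ) + 1) * a * α ^ k).re = 0) :
    ∀ s : ℝ, ((starRingEnd ℂ) α * (a * (((s : ℂ) * α) ^ (k + 1) - α ^ (k + 1)))).re = 0 := by
  intro s
  have hre : (a * α ^ k).re = 0 := by
    have hcast : ((k : ℂ) + 1) * a * α ^ k = (((k : ℝ) + 1 : ℝ) : ℂ) * (a * α ^ k) := by
      push_cast
      ring
    rw [hcast, re_ofReal_mul] at hmult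
    exact (mul_eq_zero.mp hmult).resolve_left (by positivity)
  have hfactor : (starRingEnd ℂ) α * (a * (((s : ℂ) * α) ^ (k + 1) - α ^ (k + 1))) =
      ((normSq α * (s ^ (k + 1) - 1) : ℝ) : ℂ) * (a * α ^ k) := by
    push_cast
    rw [normSq_eq_conj_mul_self]
    ring
  rw [hfactor, re_ofReal_mul, hre, mul_zero]
end
end
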